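/- arXiv:2510.04714 — 3 statements merged into one kernel-verified Lean document; each statement's English description precedes it below -/
import Mathlib

section
/- Let Ω be a probability space, let 𝓔, 𝓞, 𝓩 be finite nonempty types, and let E : Ω → 𝓔, O₁ O₂ : Ω → 𝓞, Z : Ω → 𝓩 be measurable random variables. Fix z : 𝓩 with ℙ(Z = z) > 0 and assume ℙ(O₁ = o ∧ O₂ = o' ∧ Z = z) > 0 for every o, o' : 𝓞. Suppose (conditional sufficiency) for all e : 𝓔 and o, o' : 𝓞, ℙ(E = e ∣ O₁ = o ∧ O₂ = o' ∧ Z = z) = ℙ(E = e ∣ O₁ = o ∧ O₂ = o'), and (decoupled posteriors) for all o, o' : 𝓞, ℙ(O₁ = o ∧ O₂ = o' ∣ Z = z) = ℙ(O₁ = o ∣ Z = z) · ℙ(O₂ = o' ∣ Z = z). Then for every e : 𝓔, ℙ(E = e ∣ Z = z) = ∑_{o : 𝓞} ∑_{o' : 𝓞} ℙ(E = e ∣ O₁ = o ∧ O₂ = o') · ℙ(O₁ = o ∣ Z = z) · ℙ(O₂ = o' ∣ Z = z). -/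
open MeasureTheory ProbabilityTheory

theorem aux_sum {Ω A : Type*} [MeasurableSpace Ω] [Fintype A] [MeasurableSpace A]
    [MeasurableSingletonClass A] (ν : Measure Ω) (X : Ω → A) (hX : Measurable X)
    (S : Set Ω) : ν S = ∑ a : A, ν ({ω | X ω = a} ∩ S) := by
  have h := sum_measure_preimage_singleton (μ := ν.restrict S) (f := X) Finset.univ
    (fun y _ => hX (measurableSet_singleton y))
  simp only [Finset.coe_univ, Set.preimage_univ, Measure.restrict_apply_univ] at h
  rw [← h]
  refine Finset.sum_congr rfl fun a _ => ?_
  rw [Measure.restrict_apply (hX (measurableSet_singleton a))]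
  rfl

theorem predicate_factorization
    {Ω : Type*} [MeasurableSpace Ω] (μ : Measure Ω) [IsProbabilityMeasure μ]
    {𝓔 𝓞 𝓩 : Type*}
    [Fintype 𝓔] [Nonempty 𝓔] [MeasurableSpace 𝓔] [MeasurableSingletonClass 𝓔]
    [Fintype 𝓞] [Nonempty 𝓞] [MeasurableSpace 𝓞] [MeasurableSingletonClass 𝓞]
    [Fintype 𝓩] [Nonempty 𝓩] [MeasurableSpace 𝓩] [MeasurableSingletonClass 𝓩]
    (E : Ω → 𝓔) (O₁ O₂ : Ω → 𝓞) (Z : Ω → 𝓩)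
    (hE : Measurable E) (hO₁ : Measurable O₁) (hO₂ : Measurable O₂) (hZ : Measurable Z)
    (z : 𝓩) (hz : 0 < μ {ω | Z ω = z})
    (hpos : ∀ o o' : 𝓞, 0 < μ {ω | O₁ ω = o ∧ O₂ ω = o' ∧ Z ω = z})
    (hsuff : ∀ (e : 𝓔) (o o' : 𝓞),
      ProbabilityTheory.cond μ {ω | O₁ ω = o ∧ O₂ ω = o' ∧ Z ω = z} {ω | E ω = e} =
      ProbabilityTheory.cond μ {ω | O₁ ω = o ∧ O₂ ω = o'} {ω | E ω = e})
    (hdec : ∀ o o' : 𝓞,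
      ProbabilityTheory.cond μ {ω | Z ω = z} {ω | O₁ ω = o ∧ O₂ ω = o'} =
      ProbabilityTheory.cond μ {ω | Z ω = z} {ω | O₁ ω = o} *
        ProbabilityTheory.cond μ {ω | Z ω = z} {ω | O₂ ω = o'}) :
    ∀ e : 𝓔,
      ProbabilityTheory.cond μ {ω | Z ω = z} {ω | E ω = e} =
      ∑ o : 𝓞, ∑ o' : 𝓞,
        ProbabilityTheory.cond μ {ω | O₁ ω = o ∧ O₂ ω = o'} {ω | E ω = e} *
          ProbabilityTheory.cond μ {ω | Z ω = z} {ω | O₁ ω = o} *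
          ProbabilityTheory.cond μ {ω | Z ω = z} {ω | O₂ ω = o'} := by
  intro e
  have m1 : ∀ o, MeasurableSet {ω | O₁ ω = o} := fun o => hO₁ (measurableSet_singleton o)
  have m2 : ∀ o, MeasurableSet {ω | O₂ ω = o} := fun o => hO₂ (measurableSet_singleton o)
  have mZ : MeasurableSet {ω | Z ω = z} := hZ (measurableSet_singleton z)
  rw [aux_sum _ O₁ hO₁]
  refine Finset.sum_congr rfl fun o _ => ?_
  rw [aux_sum _ O₂ hO₂]
  refine Finset.sum_congr rfl fun o' _ => ?_
  rw [mul_assoc, ← hdec, ← hsuff, cond_apply mZ, cond_apply mZ, mul_left_comm]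
  congr 1
  have hs : {ω | Z ω = z} ∩ {ω | O₁ ω = o ∧ O₂ ω = o'} =
      {ω | O₁ ω = o ∧ O₂ ω = o' ∧ Z ω = z} := by
    ext ω; simp only [Set.mem_inter_iff, Set.mem_setOf_eq]; tauto
  have mA : MeasurableSet {ω | O₁ ω = o ∧ O₂ ω = o' ∧ Z ω = z} :=
    (m1 o).inter ((m2 o').inter mZ)
  rw [hs, cond_mul_eq_inter mA]
  congr 1
  ext ω; simp only [Set.mem_inter_iff, Set.mem_setOf_eq]; tauto
end

section
/- Let d be a positive natural number, τ > 0 a real number, and work in the real inner product space EuclideanSpace ℝ (Fin d). Let B be a finite nonempty index set, let t : B → EuclideanSpace ℝ (Fin d), let P ⊆ B be a nonempty subset of positive indices and N = B \ P the nonempty set of negative indices, and suppose there is a vector t★ with t p = t★ for every p ∈ P. Define L : EuclideanSpace ℝ (Fin d) → ℝ by L(z) = -⟪z, t★⟫/τ + log (∑_{a ∈ B} exp(⟪z, t a⟫/τ)). Then L is differentiable at every z, and its gradient satisfies -∇L(z) = (q(z)/τ) • (t★ - (Ñ(z))⁻¹ • ∑_{n ∈ N} exp(⟪z, t n⟫/τ)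 • t n), where Ñ(z) = ∑_{n ∈ N} exp(⟪z, t n⟫/τ), U(z) = ∑_{a ∈ B} exp(⟪z, t a⟫/τ), and q(z) = Ñ(z)/U(z). -/
open RealInnerProductSpace Finset

theorem npc_gradient
    {d : ℕ} (hd : 0 < d) {τ : ℝ} (hτ : 0 < τ)
    {ι : Type*} [DecidableEq ι] (B P : Finset ι)
    (hB : B.Nonempty) (hPB : P ⊆ B) (hP : P.Nonempty) (hN : (B \ P).Nonempty)
    (t : ι → EuclideanSpace ℝ (Fin d)) (tStar : EuclideanSpace ℝ (Fin d))
    (ht : ∀ p ∈ P, t p = tStar)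
    (L : EuclideanSpace ℝ (Fin d) → ℝ)
    (hL : L = fun z => -⟪z, tStar⟫ / τ + Real.log (∑ a ∈ B, Real.exp (⟪z, t a⟫ / τ))) :
    ∀ z : EuclideanSpace ℝ (Fin d),
      DifferentiableAt ℝ L z ∧
      -gradient L z =
        (((∑ n ∈ B \ P, Real.exp (⟪z, t n⟫ / τ)) /
            (∑ a ∈ B, Real.exp (⟪z, t a⟫ / τ))) / τ) •
          (tStar - (∑ n ∈ B \ P, Real.exp (⟪z, t n⟫ / τ))⁻¹ •
            ∑ n ∈ B \ P, Real.exp (⟪z, t n⟫ / τ) • t n) := by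
  intro z
  have hi : ∀ v : EuclideanSpace ℝ (Fin d),
      HasFDerivAt (fun z : EuclideanSpace ℝ (Fin d) => ⟪z, v⟫) (innerSL ℝ v) z := by
    intro v
    have h := (innerSL ℝ v).hasFDerivAt (x := z)
    refine h.congr_of_eventuallyEq (Filter.Eventually.of_forall fun y => ?_)
    simp [real_inner_comm]
  have hUpos : 0 < ∑ a ∈ B, Real.exp (⟪z, t a⟫ / τ) :=
    Finset.sum_pos (fun _ _ => Real.exp_pos _) hB
  have hNpos : 0 < ∑ a ∈ B \ P, Real.exp (⟪z, t a⟫ / τ) :=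
    Finset.sum_pos (fun _ _ => Real.exp_pos _) hN
  have hU : HasFDerivAt
      (fun z : EuclideanSpace ℝ (Fin d) => ∑ a ∈ B, Real.exp (⟪z, t a⟫ / τ))
      (∑ a ∈ B, Real.exp (⟪z, t a⟫ / τ) • (τ⁻¹ • innerSL ℝ (t a))) z := by
    refine HasFDerivAt.fun_sum fun a _ => ?_
    have h := ((hi (t a)).const_mul τ⁻¹).exp
    simpa only [div_eq_inv_mul] using h
  have hfd := ((hi tStar).const_mul (-τ⁻¹)).add (hU.log hUpos.ne')
  have hG : HasGradientAt L ((-τ⁻¹) • tStar + (∑ a ∈ B, Real.exp (⟪z, t a⟫ / τ))⁻¹ •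
      ∑ a ∈ B, Real.exp (⟪z, t a⟫ / τ) • (τ⁻¹ • t a)) z := by
    rw [hasGradientAt_iff_hasFDerivAt]
    have hLe : L = (fun y => -τ⁻¹ * ⟪y, tStar⟫) +
        fun x => Real.log (∑ a ∈ B, Real.exp (⟪x, t a⟫ / τ)) := by
      rw [hL]
      funext y
      simp only [Pi.add_apply]
      ring
    rw [hLe]
    refine hfd.congr_fderiv ?_
    ext1 y
    simp [inner_add_left, sum_inner, inner_smul_left]
  refine ⟨hG.differentiableAt, ?_⟩
  rw [hG.gradient]
  have hsplit := Finset.sum_sdiff (f := fun a => Real.exp (⟪z, t a⟫ / τ)) hPB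
  have hsplit2 := Finset.sum_sdiff (f := fun a => Real.exp (⟪z, t a⟫ / τ) • (τ⁻¹ • t a)) hPB
  have hP2 : ∑ a ∈ P, Real.exp (⟪z, t a⟫ / τ) • (τ⁻¹ • t a)
      = (∑ a ∈ P, Real.exp (⟪z, t a⟫ / τ)) • (τ⁻¹ • tStar) := by
    rw [Finset.sum_smul]
    exact Finset.sum_congr rfl fun a ha => by rw [ht a ha]
  have hN2 : ∑ a ∈ B \ P, Real.exp (⟪z, t a⟫ / τ) • (τ⁻¹ • t a)
      = τ⁻¹ • ∑ a ∈ B \ P, Real.exp (⟪z, t a⟫ / τ) • t a := by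
    rw [Finset.smul_sum]
    exact Finset.sum_congr rfl fun a _ => smul_comm _ _ _
  rw [← hsplit2, hP2, hN2]
  have hPe : ∑ a ∈ P, Real.exp (⟪z, t a⟫ / τ) =
      ∑ a ∈ B, Real.exp (⟪z, t a⟫ / τ) - ∑ a ∈ B \ P, Real.exp (⟪z, t a⟫ / τ) := by
    linarith
  rw [hPe]
  clear hPe hN2 hP2 hsplit2 hsplit hG hfd hU
  generalize ∑ a ∈ B \ P, Real.exp (⟪z, t a⟫ / τ) • t a = S
  generalize ∑ a ∈ B \ P, Real.exp (⟪z, t a⟫ / τ) = n at *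
  generalize ∑ a ∈ B, Real.exp (⟪z, t a⟫ / τ) = u at *
  have := hUpos.ne'
  have := hNpos.ne'
  have := hτ.ne'
  match_scalars <;> field_simp <;> ring
end

section
/- Let d be a positive natural number, τ > 0 a real number, and work in EuclideanSpace ℝ (Fin d). Let N be a finite nonempty index set, let t : N → EuclideanSpace ℝ (Fin d) be the negative embeddings, and let t★ be a fixed vector (the positive text embedding). Define the decoupled loss L_dec : EuclideanSpace ℝ (Fin d) → ℝ by L_dec(z) = -⟪z, t★⟫/τ + log (∑_{n ∈ N} exp(⟪z, t n⟫/τ)). Then L_dec is differentiable at every z, and its gradient satisfies -∇L_dec(z) = (1/τ) • (t★ - (Ñ(z))⁻¹ • ∑_{n ∈ N} exp(⟪z, t n⟫/τ) • t n), where Ñ(z) = ∑_{n ∈ N} exp(⟪z, t n⟫/τ). -/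
open RealInnerProductSpace Finset

theorem decoupled_loss_gradient
    {d : ℕ} (hd : 0 < d) {τ : ℝ} (hτ : 0 < τ)
    {ι : Type*} (N : Finset ι) (hN : N.Nonempty)
    (t : ι → EuclideanSpace ℝ (Fin d)) (tStar : EuclideanSpace ℝ (Fin d))
    (Ldec : EuclideanSpace ℝ (Fin d) → ℝ)
    (hLdec : Ldec = fun z => -⟪z, tStar⟫ / τ + Real.log (∑ n ∈ N, Real.exp (⟪z, t n⟫ / τ))) :
    ∀ z : EuclideanSpace ℝ (Fin d),
      DifferentiableAt ℝ Ldec z ∧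
      -gradient Ldec z =
        (1 / τ) •
          (tStar - (∑ n ∈ N, Real.exp (⟪z, t n⟫ / τ))⁻¹ •
            ∑ n ∈ N, Real.exp (⟪z, t n⟫ / τ) • t n) := by
  intro z
  have hpos : 0 < ∑ n ∈ N, Real.exp (⟪z, t n⟫ / τ) :=
    Finset.sum_pos (fun n _ => Real.exp_pos _) hN
  have hin : ∀ v : EuclideanSpace ℝ (Fin d),
      HasFDerivAt (fun z : EuclideanSpace ℝ (Fin d) => ⟪z, v⟫ / τ) (τ⁻¹ • innerSL ℝ v) z := by
    intro v
    have h := ((innerSL ℝ v).hasFDerivAt (x := z)).const_smul τ⁻¹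
    refine h.congr_of_eventuallyEq (Filter.Eventually.of_forall fun y => ?_)
    simp [real_inner_comm, div_eq_inv_mul]
  have hsum := HasFDerivAt.fun_sum (u := N) (fun n _ => (hin (t n)).exp)
  have hL := (hin tStar).neg.add (hsum.log hpos.ne')
  have hg : HasGradientAt Ldec (-((1 / τ) •
          (tStar - (∑ n ∈ N, Real.exp (⟪z, t n⟫ / τ))⁻¹ •
            ∑ n ∈ N, Real.exp (⟪z, t n⟫ / τ) • t n))) z := by
    rw [hasGradientAt_iff_hasFDerivAt, hLdec]
    refine (hL.congr_fderiv ?_).congr_of_eventuallyEq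
      (Filter.Eventually.of_forall fun y => ?_)
    · ext y
      simp [inner_sub_left, inner_smul_left, sum_inner, mul_sub, Finset.mul_sum]
      rw [neg_add_eq_sub]
      congr 1
      refine Finset.sum_congr rfl fun n _ => ?_
      ring
    · simp [neg_div]
  exact ⟨hg.differentiableAt, by rw [hg.gradient, neg_neg]⟩
end
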